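/- Let t ∈ ℂ be transcendental over ℚ. Then dim_ℂ 𝒮_t = dim_ℂ 𝒮_1, i.e., the ℂ-subalgebra of Mat_{(m+n)^r}(ℂ) generated by the specialized Hecke operators T_1(t), …, T_{r−1}(t) has the same dimension as the ℂ-subalgebra generated by the signed swap operators P_1, …, P_{r−1} (the specialization at t = 1). -/

import Mathlib

set_option synthInstance.maxHeartbeats 1000000
set_option maxHeartbeats 1000000

open scoped BigOperators Kronecker

section CommonDefs

variable {R : Type*} [CommRing R]

/-- ℤ₂-degree of the basis vector `v_{k+1}` (0-based index `k`): `0` if `k < m`, else `1`. -/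
def deg (m : ℕ) {N : ℕ} (k : Fin N) : ℕ := if (k : ℕ) < m then 0 else 1

/-- The sign `(−1)^{|v_k||v_l|}`. -/
def sgn (R : Type*) [CommRing R] (m : ℕ) {N : ℕ} (k l : Fin N) : R :=
  (-1 : R) ^ (deg m k * deg m l)

/-- Entries (row = input vector) of the operator `T` on `V ⊗ V`, where `x` plays the
role of `q` and `xinv` that of `q⁻¹`:  `T(v_k ⊗ v_k) = q·v_k ⊗ v_k` if `k ≤ m`,
`T(v_k ⊗ v_k) = −q⁻¹·v_k ⊗ v_k` if `k > m`,
`T(v_k ⊗ v_l) = (−1)^{|v_k||v_l|} v_l ⊗ v_k + (q−q⁻¹) v_k ⊗ v_l` if `k < l`, and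
`T(v_k ⊗ v_l) = (−1)^{|v_k||v_l|} v_l ⊗ v_k` if `k > l`. -/
def Tent (x xinv : R) (m : ℕ) {N : ℕ} (p p' : Fin N × Fin N) : R :=
  if p.1 = p.2 then (if (p.1 : ℕ) < m then x else -xinv) * (if p' = p then 1 else 0)
  else if (p.1 : ℕ) < (p.2 : ℕ) then
    sgn R m p.1 p.2 * (if p' = (p.2, p.1) then 1 else 0)
      + (x - xinv) * (if p' = p then 1 else 0)
  else sgn R m p.1 p.2 * (if p' = (p.2, p.1) then 1 else 0)

/-- Entries of the signed swap `P(v_k ⊗ v_l) = (−1)^{|v_k||v_l|} v_l ⊗ v_k`. -/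
def Pent (R : Type*) [CommRing R] (m : ℕ) {N : ℕ} (p p' : Fin N × Fin N) : R :=
  sgn R m p.1 p.2 * (if p' = (p.2, p.1) then 1 else 0)

/-- The operator `Id^{⊗ i} ⊗ E ⊗ Id^{⊗ (r−i−2)}` on `V^{⊗ r}` obtained from a two-site
operator `E` acting on the (0-based) tensor positions `i` and `i+1`. -/
def twoSiteOp {N : ℕ} (E : Fin N × Fin N → Fin N × Fin N → R) (r i : ℕ) (h : i + 1 < r) :
    Matrix (Fin r → Fin N) (Fin r → Fin N) R := fun a b =>
  E (a ⟨i, Nat.lt_of_succ_lt h⟩, a ⟨i + 1, h⟩) (b ⟨i, Nat.lt_of_succ_lt h⟩, b ⟨i + 1, h⟩) *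
    ∏ j ∈ Finset.univ \ ({⟨i, Nat.lt_of_succ_lt h⟩, ⟨i + 1, h⟩} : Finset (Fin r)),
      (if a j = b j then (1 : R) else 0)

/-- The Hecke operator `T_{i+1} = Id^{⊗ i} ⊗ T ⊗ Id^{⊗ (r−i−2)}` on `V^{⊗ r}`
(here `i` is the 0-based position of the first tensor factor it acts on). -/
def heckeOp (x xinv : R) (m : ℕ) {N : ℕ} (r i : ℕ) (h : i + 1 < r) :
    Matrix (Fin r → Fin N) (Fin r → Fin N) R :=
  twoSiteOp (Tent x xinv m) r i h

/-- The signed swap operator `P_{i+1} = Id^{⊗ i} ⊗ P ⊗ Id^{⊗ (r−i−2)}` on `V^{⊗ r}`. -/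
def swapOp (R : Type*) [CommRing R] (m : ℕ) {N : ℕ} (r i : ℕ) (h : i + 1 < r) :
    Matrix (Fin r → Fin N) (Fin r → Fin N) R :=
  twoSiteOp (Pent R m) r i h

/-- The parity operator `S v_j = (−1)^{|v_j|} v_j`. -/
def Smat (R : Type*) [CommRing R] (m : ℕ) {N : ℕ} : Matrix (Fin N) (Fin N) R :=
  fun a b => if a = b then (-1 : R) ^ deg m a else 0

/-- The diagonal operator `Q_b v_j = q^{δ_{bj}} v_j` (`x` playing the role of `q`, or of
`q⁻¹` for the inverse operator). -/
def Qmat (x : R) {N : ℕ} (b0 : Fin N) : Matrix (Fin N) (Fin N) R :=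
  fun a b => if a = b then (if a = b0 then x else 1) else 0

/-- `E_k v_{k+1} = v_k`, `E_k v_j = 0` otherwise (0-based `k`; row = input). -/
def Emat (R : Type*) [CommRing R] {N : ℕ} (k : ℕ) : Matrix (Fin N) (Fin N) R :=
  fun a b => if (a : ℕ) = k + 1 ∧ (b : ℕ) = k then 1 else 0

/-- `F_k v_k = v_{k+1}`, `F_k v_j = 0` otherwise (0-based `k`; row = input). -/
def Fmat (R : Type*) [CommRing R] {N : ℕ} (k : ℕ) : Matrix (Fin N) (Fin N) R :=
  fun a b => if (a : ℕ) = k ∧ (b : ℕ) = k + 1 then 1 else 0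

/-- The diagonal operator `D_k v_j = q^{s(k)δ_{kj} − s(k+1)δ_{k+1,j}} v_j`
(0-based `k`, so `s(k) = 1` iff `k < m`, and `s(k) = −1` otherwise). -/
def Dmat (x xinv : R) (m : ℕ) {N : ℕ} (k : ℕ) : Matrix (Fin N) (Fin N) R :=
  fun a b => if a = b then
    (if (a : ℕ) = k then (if k < m then x else xinv)
     else if (a : ℕ) = k + 1 then (if k + 1 < m then xinv else x) else 1)
  else 0

/-- The inverse `D_k⁻¹` of `Dmat` (obtained by exchanging `q` and `q⁻¹`). -/
def Dinvmat (x xinv : R) (m : ℕ) {N : ℕ} (k : ℕ) : Matrix (Fin N) (Fin N) R :=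
  Dmat xinv x m k

/-- `S^{p(k)}`, where `p(k) = 1` if the 0-based `k` satisfies `k + 1 = m` (the odd simple
root) and `p(k) = 0` otherwise. -/
def SPmat (R : Type*) [CommRing R] (m : ℕ) {N : ℕ} (k : ℕ) : Matrix (Fin N) (Fin N) R :=
  if k + 1 = m then Smat R m else 1

/-- Kronecker (tensor) product of `r` one-site operators, as a matrix on `V^{⊗ r}`. -/
def kron {N r : ℕ} (M : Fin r → Matrix (Fin N) (Fin N) R) :
    Matrix (Fin r → Fin N) (Fin r → Fin N) R :=
  fun a b => ∏ j, M j (a j) (b j)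

/-- `ρ_r(σ) = S^{⊗ r}`. -/
def rhoSigma (R : Type*) [CommRing R] (m : ℕ) {N : ℕ} (r : ℕ) :
    Matrix (Fin r → Fin N) (Fin r → Fin N) R :=
  kron fun _ => Smat R m

/-- `ρ_r(q^{δ_b}) = Q_b^{⊗ r}` (and its inverse, substituting `q⁻¹` for `x`). -/
def rhoQ (x : R) {N : ℕ} (r : ℕ) (b0 : Fin N) :
    Matrix (Fin r → Fin N) (Fin r → Fin N) R :=
  kron fun _ => Qmat x b0

/-- `ρ_r(e_k) = Σ_{j=1}^{r} (S^{p(k)})^{⊗(j−1)} ⊗ E_k ⊗ (D_k^{−1})^{⊗(r−j)}`. -/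
def rhoE (x xinv : R) (m : ℕ) {N : ℕ} (r : ℕ) (k : ℕ) :
    Matrix (Fin r → Fin N) (Fin r → Fin N) R :=
  ∑ p : Fin r, kron fun j =>
    if j < p then SPmat R m k else if j = p then Emat R k else Dinvmat x xinv m k

/-- `ρ_r(f_k) = Σ_{j=1}^{r} (S^{p(k)}D_k)^{⊗(j−1)} ⊗ F_k ⊗ Id^{⊗(r−j)}`. -/
def rhoF (x xinv : R) (m : ℕ) {N : ℕ} (r : ℕ) (k : ℕ) :
    Matrix (Fin r → Fin N) (Fin r → Fin N) R :=
  ∑ p : Fin r, kron fun j =>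
    if j < p then SPmat R m k * Dmat x xinv m k else if j = p then Fmat R k else 1

/-- The generators `T_1, …, T_{r−1}` of the image of the sign `q`-permutation
representation of the Iwahori–Hecke algebra on `V^{⊗ r}`. -/
def heckeGens (x xinv : R) (m : ℕ) {N : ℕ} (r : ℕ) :
    Set (Matrix (Fin r → Fin N) (Fin r → Fin N) R) :=
  {M | ∃ (i : ℕ) (h : i + 1 < r), M = heckeOp x xinv m r i h}

/-- The signed-swap generators `P_1, …, P_{r−1}` (the `q → 1` specialization). -/
def swapGens (R : Type*) [CommRing R] (m : ℕ) {N : ℕ} (r : ℕ) :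
    Set (Matrix (Fin r → Fin N) (Fin r → Fin N) R) :=
  {M | ∃ (i : ℕ) (h : i + 1 < r), M = swapOp R m r i h}

/-- The generators `ρ_r(σ)`, `ρ_r(q^{± δ_b})` (`1 ≤ b ≤ N`), `ρ_r(e_k)`, `ρ_r(f_k)`
(`1 ≤ k ≤ N−1`) of the image of the vector representation of `U_q^σ(gl(m,n))`. -/
def quantumGens (x xinv : R) (m : ℕ) {N : ℕ} (r : ℕ) :
    Set (Matrix (Fin r → Fin N) (Fin r → Fin N) R) :=
  {rhoSigma R m r} ∪ (Set.range fun b : Fin N => rhoQ x r b)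
    ∪ (Set.range fun b : Fin N => rhoQ xinv r b)
    ∪ (Set.range fun k : Fin (N - 1) => rhoE x xinv m r (k : ℕ))
    ∪ (Set.range fun k : Fin (N - 1) => rhoF x xinv m r (k : ℕ))

end CommonDefs

/-- The specialized algebra `𝒮_t ⊆ Mat_{(m+n)^r}(ℂ)`, generated by the Hecke operators
with `q` replaced by the nonzero complex number `t`. -/
noncomputable def St (t : ℂ) (m n r : ℕ) :
    Subalgebra ℂ (Matrix (Fin r → Fin (m + n)) (Fin r → Fin (m + n)) ℂ) :=
  Algebra.adjoin ℂ (heckeGens t t⁻¹ m (N := m + n) r)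

/-- The specialized algebra `𝒢_t ⊆ Mat_{(m+n)^r}(ℂ)`, generated by the operators of the
vector representation with `q` replaced by the nonzero complex number `t`. -/
noncomputable def Gt (t : ℂ) (m n r : ℕ) :
    Subalgebra ℂ (Matrix (Fin r → Fin (m + n)) (Fin r → Fin (m + n)) ℂ) :=
  Algebra.adjoin ℂ (quantumGens t t⁻¹ m (N := m + n) r)

section RelativeTrace

variable {K A : Type*} [CommRing K] [Ring A] [Algebra K A]

/-- The defining relations, with parameter `c`, of the Hecke algebra on the generators
`T 0, …, T (k - 1)`. -/
structure HeckeRelations (c : K) (T : ℕ → A) (k : ℕ) : Prop where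
  quad : ∀ i < k, T i * T i = c • T i + 1
  braid : ∀ i, i + 1 < k → T i * T (i + 1) * T i = T (i + 1) * T i * T (i + 1)
  comm : ∀ i j, i + 1 < j → j < k → Commute (T i) (T j)

theorem HeckeRelations.mono {c : K} {T : ℕ → A} {k l : ℕ} (h : HeckeRelations c T k)
    (hl : l ≤ k) : HeckeRelations c T l :=
  ⟨fun i hi => h.quad i (by omega), fun i hi => h.braid i (by omega),
    fun i j hi hj => h.comm i j hi (by omega)⟩

theorem HeckeRelations.map {B : Type*} [Ring B] [Algebra K B] {c : K} {T : ℕ → A} {k : ℕ}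
    (h : HeckeRelations c T k) (f : A →ₐ[K] B) : HeckeRelations c (fun i => f (T i)) k where
  quad i hi := by rw [← map_mul, h.quad i hi, map_add, map_smul, map_one]
  braid i hi := by simp only [← map_mul, h.braid i hi]
  comm i j hi hj := (h.comm i j hi hj).map f

/-- The map `Z ↦ ∑ j ≤ k, T j ⋯ T (k - 1) * Z * T (k - 1) ⋯ T j`. -/
def relTraceStep (K : Type*) {A : Type*} [CommRing K] [Ring A] [Algebra K A] (T : ℕ → A) :
    ℕ → A →ₗ[K] A
  | 0 => LinearMap.id
  | k + 1 => LinearMap.id + relTraceStep K T k ∘ₗ LinearMap.mulLeftRight K (T k, T k)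

/-- The relative trace `Z ↦ ∑ w, T w * Z * T w⁻¹`, with `w` running over the symmetric group
on `k + 1` letters. -/
def relTrace (K : Type*) {A : Type*} [CommRing K] [Ring A] [Algebra K A] (T : ℕ → A) :
    ℕ → A →ₗ[K] A
  | 0 => LinearMap.id
  | k + 1 => relTraceStep K T (k + 1) ∘ₗ relTrace K T k

theorem relTraceStep_succ (T : ℕ → A) (k : ℕ) (Z : A) :
    relTraceStep K T (k + 1) Z = Z + relTraceStep K T k (T k * Z * T k) := by
  simp [relTraceStep]

theorem relTrace_succ (T : ℕ → A) (k : ℕ) (Z : A) :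
    relTrace K T (k + 1) Z = relTraceStep K T (k + 1) (relTrace K T k Z) := rfl

theorem commute_relTraceStep_of_commute {T : ℕ → A} {x : A} {k : ℕ}
    (hx : ∀ i < k, Commute x (T i)) {Z : A} (hZ : Commute x Z) :
    Commute x (relTraceStep K T k Z) := by
  induction k generalizing Z with
  | zero => exact hZ
  | succ k ih =>
    rw [relTraceStep_succ]
    have hk := hx k k.lt_succ_self
    exact hZ.add_right (ih (fun i hi => hx i (by omega)) ((hk.mul_right hZ).mul_right hk))

theorem HeckeRelations.commute_relTraceStep {c : K} {T : ℕ → A} {k : ℕ}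
    (h : HeckeRelations c T k) {Z : A} (hZ : ∀ i, i + 1 < k → Commute (T i) Z) :
    ∀ i < k, Commute (T i) (relTraceStep K T k Z) := by
  induction k generalizing Z with
  | zero => intro i hi; omega
  | succ k ih =>
    intro i hi
    rw [relTraceStep_succ]
    obtain hi | rfl : i < k ∨ i = k := by omega
    · refine (hZ i (by omega)).add_right (ih (h.mono k.le_succ) (fun j hj => ?_) i hi)
      have hc := h.comm j k hj k.lt_succ_self
      exact (hc.mul_right (hZ j (by omega))).mul_right hc
    · have hq := h.quad i i.lt_succ_self
      have hadd : Commute (T i) (Z + T i * Z * T i) := by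
        have h1 : T i * (T i * Z * T i) = c • (T i * Z * T i) + Z * T i := by
          rw [← mul_assoc, ← mul_assoc, hq]; simp [add_mul]
        have h2 : T i * Z * T i * T i = c • (T i * Z * T i) + T i * Z := by
          rw [mul_assoc _ (T i), hq]; simp [mul_add]
        rw [Commute, SemiconjBy, mul_add, add_mul, h1, h2]
        abel
      cases i with
      | zero => exact hadd
      | succ j =>
        rw [relTraceStep_succ, ← add_assoc]
        refine hadd.add_right (commute_relTraceStep_of_commute
          (fun l hl => (h.comm l (j + 1) (by omega) (by omega)).symm) ?_)
        have hb := h.braid j (by omega)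
        have hj : T j * Z = Z * T j := hZ j (by omega)
        calc T (j + 1) * (T j * (T (j + 1) * Z * T (j + 1)) * T j)
            = (T (j + 1) * T j * T (j + 1)) * Z * (T (j + 1) * T j) := by
              simp only [mul_assoc]
          _ = T j * T (j + 1) * (T j * Z) * (T (j + 1) * T j) := by
              rw [← hb]; simp only [mul_assoc]
          _ = T j * T (j + 1) * Z * (T j * T (j + 1) * T j) := by
              rw [hj]; simp only [mul_assoc]
          _ = T j * (T (j + 1) * Z * T (j + 1)) * T j * T (j + 1) := by
              rw [hb]; simp only [mul_assoc]

/-- The relative trace takes values in the commutant of the Hecke algebra. -/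
theorem HeckeRelations.commute_relTrace {c : K} {T : ℕ → A} {k : ℕ}
    (h : HeckeRelations c T k) (Z : A) : ∀ i < k, Commute (T i) (relTrace K T k Z) := by
  induction k with
  | zero => intro i hi; omega
  | succ k ih =>
    rw [relTrace_succ]
    exact h.commute_relTraceStep fun i hi => ih (h.mono k.le_succ) i (by omega)

theorem relTraceStep_of_involutive {T : ℕ → A} {k : ℕ} (hT : ∀ i < k, T i * T i = 1) {Z : A}
    (hZ : ∀ i < k, Commute (T i) Z) : relTraceStep K T k Z = ((k + 1 : ℕ) : K) • Z := by
  induction k with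
  | zero => simp [relTraceStep]
  | succ k ih =>
    have hk : T k * Z * T k = Z := by
      rw [(hZ k k.lt_succ_self).eq, mul_assoc, hT k k.lt_succ_self, mul_one]
    rw [relTraceStep_succ, hk, ih (fun i hi => hT i (by omega)) fun i hi => hZ i (by omega)]
    push_cast
    module

theorem relTrace_of_involutive {T : ℕ → A} {k : ℕ} (hT : ∀ i < k, T i * T i = 1) {Z : A}
    (hZ : ∀ i < k, Commute (T i) Z) :
    relTrace K T k Z = ((k + 1).factorial : K) • Z := by
  induction k with
  | zero => simp [relTrace]
  | succ k ih =>
    rw [relTrace_succ, ih (fun i hi => hT i (by omega)) fun i hi => hZ i (by omega), map_smul,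
      relTraceStep_of_involutive hT hZ, smul_smul, (k + 1).factorial_succ, mul_comm]
    push_cast
    rfl

theorem map_relTraceStep {L B : Type*} [CommRing L] [Ring B] [Algebra L B] (f : A →+* B)
    (T : ℕ → A) (k : ℕ) (Z : A) :
    f (relTraceStep K T k Z) = relTraceStep L (fun i => f (T i)) k (f Z) := by
  induction k generalizing Z with
  | zero => rfl
  | succ k ih => simp only [relTraceStep_succ, map_add, map_mul, ih]

theorem map_relTrace {L B : Type*} [CommRing L] [Ring B] [Algebra L B] (f : A →+* B)
    (T : ℕ → A) (k : ℕ) (Z : A) :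
    f (relTrace K T k Z) = relTrace L (fun i => f (T i)) k (f Z) := by
  induction k with
  | zero => rfl
  | succ k ih => simp only [relTrace_succ, map_relTraceStep (L := L), ih]

end RelativeTrace

section Specialization

variable {R K L : Type*} [CommRing R] [Field K] [Field L]

/-- The rank of a family of vectors cannot go up under specialization. -/
theorem finrank_span_specialization_le {ι κ : Type*} [Finite κ] (φ : R →+* K)
    (hφ : Function.Injective φ) (ψ : R →+* L) (v : ι → κ → R) :
    Module.finrank L (Submodule.span L (Set.range fun i => ψ ∘ v i)) ≤
      Module.finrank K (Submodule.span K (Set.range fun i => φ ∘ v i)) := by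
  classical
  have := Fintype.ofFinite κ
  obtain ⟨ι', a, -, hspan, hli⟩ := exists_linearIndependent' L fun i => ψ ∘ v i
  have : Finite ι' := hli.finite
  have := Fintype.ofFinite ι'
  have hrow : (Matrix.of fun i => ψ ∘ v (a i)).rank = Fintype.card ι' := hli.rank_matrix
  obtain ⟨κ', b, -, hspan', hli'⟩ :=
    exists_linearIndependent' L (Matrix.of fun i => ψ ∘ v (a i)).col
  have : Finite κ' := hli'.finite
  have := Fintype.ofFinite κ'
  have hcard : Fintype.card κ' = Fintype.card ι' := by
    rw [← hrow, Matrix.rank_eq_finrank_span_cols, ← hspan', finrank_span_eq_card hli']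
  let e : ι' ≃ κ' := Fintype.equivOfCardEq hcard.symm
  let M : Matrix ι' ι' R := Matrix.of fun i j => v (a i) (b (e j))
  have hψ : (M.map ψ).det ≠ 0 := by
    have h := hli'.comp e e.injective
    exact ((Matrix.linearIndependent_cols_iff_isUnit (A := M.map ψ)).1 h |>.map
      Matrix.detMonoidHom).ne_zero
  have hφM : (M.map φ).det ≠ 0 := by
    rw [← RingHom.mapMatrix_apply, ← RingHom.map_det] at hψ ⊢
    exact (map_ne_zero_iff φ hφ).2 fun h0 => hψ (by rw [h0, map_zero])
  have hliφ : LinearIndependent K fun i => φ ∘ v (a i) := by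
    have h := Matrix.linearIndependent_rows_of_det_ne_zero hφM
    exact LinearIndependent.of_comp (LinearMap.funLeft K K fun j => b (e j)) h
  rw [← hspan, finrank_span_eq_card hli, ← finrank_span_eq_card hliφ]
  exact Submodule.finrank_mono (Submodule.span_mono (Set.range_comp_subset_range a fun i => φ ∘ v i))

end Specialization

section Commutant

variable {n : Type*} [DecidableEq n]

/-- The coefficients of the equation `(W * X - X * W) a b = 0` in the unknown matrix `W`. -/
def commutatorRow {R U : Type*} [CommRing R] (X : U → Matrix n n R) (p : U × n × n) :
    n × n → R :=
  fun e => (if p.2.1 = e.1 then X p.1 e.2 p.2.2 else 0) -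
    if e.2 = p.2.2 then X p.1 p.2.1 e.1 else 0

theorem comp_commutatorRow {R S U : Type*} [CommRing R] [CommRing S] (φ : R →+* S)
    (X : U → Matrix n n R) (p : U × n × n) :
    φ ∘ commutatorRow X p = commutatorRow (fun u => (X u).map φ) p := by
  ext e
  simp [commutatorRow, apply_ite φ]

variable [Fintype n]

theorem sum_commutatorRow {R U : Type*} [CommRing R] (X : U → Matrix n n R) (u : U) (a b : n)
    (W : Matrix n n R) :
    ∑ e, commutatorRow X (u, a, b) e * W e.1 e.2 = (W * X u - X u * W) a b := by
  simp only [commutatorRow, sub_mul, Finset.sum_sub_distrib, Fintype.sum_prod_type, Matrix.sub_apply,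
    Matrix.mul_apply, ite_mul, zero_mul, Finset.sum_ite_eq', Finset.mem_univ,
    if_true]
  rw [Finset.sum_comm]
  simp [mul_comm]

theorem finrank_centralizer_add {K U : Type*} [Field K] [Finite U] (X : U → Matrix n n K) :
    Module.finrank K (Subalgebra.centralizer K (Set.range X)) +
      Module.finrank K (Submodule.span K (Set.range (commutatorRow X))) =
      Fintype.card (n × n) := by
  have := Fintype.ofFinite U
  let e : Matrix n n K ≃ₗ[K] (n × n → K) :=
    (Matrix.ofLinearEquiv K).symm ≪≫ₗ (LinearEquiv.curry K K n n).symm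
  let B : Matrix (U × n × n) (n × n) K := Matrix.of (commutatorRow X)
  have hker : LinearMap.ker (B.mulVecLin ∘ₗ e.toLinearMap) =
      Subalgebra.toSubmodule (Subalgebra.centralizer K (Set.range X)) := by
    ext W
    have hB : ∀ p, (B.mulVecLin ∘ₗ e.toLinearMap) W p = (W * X p.1 - X p.1 * W) p.2.1 p.2.2 :=
      fun p => sum_commutatorRow X p.1 p.2.1 p.2.2 W
    simp only [LinearMap.mem_ker, funext_iff, hB, Subalgebra.mem_toSubmodule,
      Subalgebra.mem_centralizer_iff, Set.forall_mem_range, Pi.zero_apply, Prod.forall]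
    refine forall_congr' fun u => ?_
    rw [eq_comm (a := X u * W), ← sub_eq_zero, ← Matrix.ext_iff]
    rfl
  have hrange : Module.finrank K (LinearMap.range (B.mulVecLin ∘ₗ e.toLinearMap)) =
      Module.finrank K (Submodule.span K (Set.range (commutatorRow X))) := by
    rw [LinearEquiv.range_comp]
    exact B.rank_eq_finrank_span_row
  have h := (B.mulVecLin ∘ₗ e.toLinearMap).finrank_range_add_finrank_ker
  rw [hrange, hker, e.finrank_eq, Module.finrank_fintype_fun_eq_card] at h
  rw [← h, add_comm]
  rfl

/-- The dimension of a commutant cannot go down under specialization. -/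
theorem finrank_centralizer_le_specialization {R K L U : Type*} [CommRing R] [Field K] [Field L]
    [Finite U] (φ : R →+* K) (hφ : Function.Injective φ) (ψ : R →+* L) (X : U → Matrix n n R) :
    Module.finrank K (Subalgebra.centralizer K (Set.range fun u => (X u).map φ)) ≤
      Module.finrank L (Subalgebra.centralizer L (Set.range fun u => (X u).map ψ)) := by
  have h := finrank_span_specialization_le φ hφ ψ (commutatorRow X)
  have hφ' : (fun p => φ ∘ commutatorRow X p) = commutatorRow fun u => (X u).map φ :=
    funext (comp_commutatorRow φ X)
  have hψ' : (fun p => ψ ∘ commutatorRow X p) = commutatorRow fun u => (X u).map ψ :=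
    funext (comp_commutatorRow ψ X)
  rw [hφ', hψ'] at h
  have h1 := finrank_centralizer_add fun u => (X u).map φ
  have h2 := finrank_centralizer_add fun u => (X u).map ψ
  omega

theorem toSubmodule_adjoin_range {K A ι : Type*} [CommRing K] [Ring A] [Algebra K A]
    (T : ι → A) :
    Subalgebra.toSubmodule (Algebra.adjoin K (Set.range T)) =
      Submodule.span K (Set.range (FreeMonoid.lift T)) := by
  rw [Algebra.adjoin_eq_span, ← FreeMonoid.mrange_lift, MonoidHom.coe_mrange]

theorem finrank_span_map_lift {R K ι : Type*} [CommRing R] [Field K] (f : R →+* K)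
    (T : ι → Matrix n n R) :
    Module.finrank K (Submodule.span K (Set.range fun w : FreeMonoid ι =>
        f ∘ fun e : n × n => FreeMonoid.lift T w e.1 e.2)) =
      Module.finrank K (Algebra.adjoin K (Set.range fun i => (T i).map f)) := by
  let e : Matrix n n K ≃ₗ[K] (n × n → K) :=
    (Matrix.ofLinearEquiv K).symm ≪≫ₗ (LinearEquiv.curry K K n n).symm
  have hlift : ∀ w : FreeMonoid ι,
      FreeMonoid.lift (fun i => (T i).map f) w = (FreeMonoid.lift T w).map f := fun w =>
    (DFunLike.congr_fun
      (FreeMonoid.comp_lift (f.mapMatrix (m := n)).toMonoidHom T) w).symm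
  have hrange : (Set.range fun w : FreeMonoid ι =>
      f ∘ fun e : n × n => FreeMonoid.lift T w e.1 e.2) =
      e '' Set.range (FreeMonoid.lift fun i => (T i).map f) := by
    rw [← Set.range_comp]
    congr 1
    funext w
    rw [Function.comp_apply, hlift]
    rfl
  rw [hrange, ← LinearEquiv.coe_coe, ← Submodule.map_span, LinearEquiv.finrank_map_eq,
    ← toSubmodule_adjoin_range]
  rfl

/-- The dimension of a matrix algebra cannot go up under specialization of its generators. -/
theorem finrank_adjoin_specialization_le {R K L ι : Type*} [CommRing R] [Field K] [Field L]
    (φ : R →+* K) (hφ : Function.Injective φ) (ψ : R →+* L) (T : ι → Matrix n n R) :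
    Module.finrank L (Algebra.adjoin L (Set.range fun i => (T i).map ψ)) ≤
      Module.finrank K (Algebra.adjoin K (Set.range fun i => (T i).map φ)) := by
  rw [← finrank_span_map_lift, ← finrank_span_map_lift]
  exact finrank_span_specialization_le φ hφ ψ _

variable {K : Type*} [Field K]

theorem relTraceStep_mem {T : ℕ → Matrix n n K} {S : Subalgebra K (Matrix n n K)}
    (hT : ∀ i, T i ∈ S) (k : ℕ) {Z : Module.End K (Matrix n n K)} (hZ : ∀ M, Z M ∈ S)
    (M : Matrix n n K) :
    relTraceStep K (fun i => Algebra.lmul K (Matrix n n K) (T i)) k Z M ∈ S := by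
  induction k generalizing Z with
  | zero => exact hZ M
  | succ k ih =>
    rw [relTraceStep_succ]
    exact S.add_mem (hZ M) (ih fun N => S.mul_mem (hT k) (hZ _))

theorem relTrace_mem {T : ℕ → Matrix n n K} {S : Subalgebra K (Matrix n n K)}
    (hT : ∀ i, T i ∈ S) (k : ℕ) {Z : Module.End K (Matrix n n K)} (hZ : ∀ M, Z M ∈ S)
    (M : Matrix n n K) :
    relTrace K (fun i => Algebra.lmul K (Matrix n n K) (T i)) k Z M ∈ S := by
  induction k generalizing M with
  | zero => exact hZ M
  | succ k ih =>
    rw [relTrace_succ]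
    exact relTraceStep_mem hT _ ih M

theorem relTraceStep_apply_of_mem {T : ℕ → Matrix n n K} {S : Subalgebra K (Matrix n n K)}
    (hT : ∀ i, T i ∈ S) {k : ℕ} (hinv : ∀ i < k, T i * T i = 1)
    {Z : Module.End K (Matrix n n K)} {c : K} (hZ : ∀ M ∈ S, Z M = c • M) :
    ∀ M ∈ S, relTraceStep K (fun i => Algebra.lmul K (Matrix n n K) (T i)) k Z M =
      (((k + 1 : ℕ) : K) * c) • M := by
  induction k generalizing Z with
  | zero => intro M hM; simpa [relTraceStep] using hZ M hM
  | succ k ih =>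
    intro M hM
    rw [relTraceStep_succ, LinearMap.add_apply, hZ M hM,
      ih (fun i hi => hinv i (by omega)) (fun N hN => ?_) M hM]
    · push_cast
      module
    · change T k * Z (T k * N) = c • N
      rw [hZ _ (S.mul_mem (hT k) hN), mul_smul_comm, ← mul_assoc, hinv k k.lt_succ_self, one_mul]

theorem relTrace_apply_of_mem {T : ℕ → Matrix n n K} {S : Subalgebra K (Matrix n n K)}
    (hT : ∀ i, T i ∈ S) {k : ℕ} (hinv : ∀ i < k, T i * T i = 1)
    {Z : Module.End K (Matrix n n K)} (hZ : ∀ M ∈ S, Z M = M) :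
    ∀ M ∈ S, relTrace K (fun i => Algebra.lmul K (Matrix n n K) (T i)) k Z M =
      ((k + 1).factorial : K) • M := by
  induction k with
  | zero => intro M hM; simpa [relTrace] using hZ M hM
  | succ k ih =>
    intro M hM
    rw [relTrace_succ, relTraceStep_apply_of_mem hT hinv (ih fun i hi => hinv i (by omega)) M hM,
      (k + 1).factorial_succ]
    push_cast
    rfl

/-- A matrix commuting with the commutant of `S` is linear with respect to every endomorphism of
the left `S`-module of all matrices. -/
theorem map_mul_of_mem_centralizer_centralizer {S : Set (Matrix n n K)}
    {p : Module.End K (Matrix n n K)} (hp : ∀ X ∈ S, ∀ M, p (X * M) = X * p M)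
    {W : Matrix n n K} (hW : W ∈ S.centralizer.centralizer) (M : Matrix n n K) :
    p (W * M) = W * p M := by
  /- `B j k` is the endomorphism of the column space that sends `v` to column `k` of the image
  under `p` of the matrix with column `j` equal to `v`. -/
  let B (j k : n) : Matrix n n K := .of fun a b => p (.single b j 1) a k
  have hB : ∀ (X : Matrix n n K) (j k a b : n), (B j k * X) a b = p (X * .single b j 1) a k := by
    intro X j k a b
    have : X * .single b j (1 : K) = ∑ c, X c b • .single c j (1 : K) := by
      ext i l
      rw [Matrix.sum_apply]
      by_cases hl : j = l
      · subst hl; simp [Matrix.single_apply]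
      · simp [Matrix.mul_apply, hl]
    rw [this, map_sum, Matrix.sum_apply, Matrix.mul_apply]
    simp only [map_smul, Matrix.smul_apply, smul_eq_mul, mul_comm]
    rfl
  have hB' : ∀ (X : Matrix n n K) (j k a b : n), (X * B j k) a b = (X * p (.single b j 1)) a k :=
    fun X j k a b => rfl
  have hcomm : ∀ j k, B j k ∈ S.centralizer := fun j k X hX => by
    ext a b
    rw [hB, hB', hp X hX]
  have hsingle : ∀ b j, p (W * .single b j 1) = W * p (.single b j 1) := fun b j => by
    ext a k
    rw [← hB, ← hB', hW _ (hcomm j k)]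
  have : p ∘ₗ LinearMap.mulLeft K W = LinearMap.mulLeft K W ∘ₗ p := by
    refine Matrix.ext_linearMap K fun b j => LinearMap.ext_ring ?_
    simpa using hsingle b j
  exact LinearMap.congr_fun this M

/-- The double commutant theorem for a matrix algebra generated by an image of a symmetric
group. -/
theorem centralizer_centralizer_le_adjoin [CharZero K] {T : ℕ → Matrix n n K} {k : ℕ}
    (h : HeckeRelations (0 : K) T k) (hk : ∀ i, k ≤ i → T i = 1) :
    (Set.range T).centralizer.centralizer ⊆ (Algebra.adjoin K (Set.range T) : Set _) := by
  intro W hW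
  set S := Algebra.adjoin K (Set.range T) with hS
  have hT : ∀ i, T i ∈ S := fun i => Algebra.subset_adjoin ⟨i, rfl⟩
  have hinv : ∀ i < k, T i * T i = 1 := fun i hi => by simpa using h.quad i hi
  obtain ⟨q, hq⟩ := (Subalgebra.toSubmodule S).subtype.exists_leftInverse_of_injective
    (Submodule.ker_subtype _)
  let Z : Module.End K (Matrix n n K) := (Subalgebra.toSubmodule S).subtype ∘ₗ q
  have hZmem : ∀ M, Z M ∈ S := fun M => (q M).2
  have hZ : ∀ M ∈ S, Z M = M := fun M hM =>
    congrArg Subtype.val (LinearMap.congr_fun hq ⟨M, hM⟩)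
  let p := relTrace K (fun i => Algebra.lmul K (Matrix n n K) (T i)) k Z
  have hp : ∀ X ∈ Set.range T, ∀ M, p (X * M) = X * p M := by
    rintro _ ⟨i, rfl⟩ M
    by_cases hi : i < k
    · exact (LinearMap.congr_fun ((h.map (Algebra.lmul K _)).commute_relTrace Z i hi) M).symm
    · rw [hk i (by omega), one_mul, one_mul]
  have h1 := map_mul_of_mem_centralizer_centralizer hp hW 1
  rw [relTrace_apply_of_mem hT hinv hZ 1 S.one_mem, mul_smul_comm, mul_one] at h1
  have hmem : ((k + 1).factorial : K) • W ∈ S := h1 ▸ relTrace_mem hT k hZmem W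
  have hne : ((k + 1).factorial : K) ≠ 0 := by exact_mod_cast (k + 1).factorial_ne_zero
  simpa [hne] using S.smul_mem hmem ((k + 1).factorial : K)⁻¹

end Commutant

section HeckeOperators

variable {R : Type*} [CommRing R] {N r : ℕ}

theorem sgn_comm (m : ℕ) (k l : Fin N) : sgn R m k l = sgn R m l k := by
  rw [sgn, sgn, mul_comm]

theorem sgn_mul_self (m : ℕ) (k l : Fin N) : sgn R m k l * sgn R m k l = 1 := by
  rw [sgn, ← mul_pow, neg_mul_neg, one_mul, one_pow]

/-- The coefficient of `v_l ⊗ v_k` in `T (v_k ⊗ v_l)` for `k ≠ l`. -/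
def swapCoeff (R : Type*) [CommRing R] (m : ℕ) (k l : Fin N) : R :=
  if k = l then 0 else sgn R m k l

/-- The coefficient of `v_k ⊗ v_l` in `T (v_k ⊗ v_l)`. -/
def diagCoeff (x xinv : R) (m : ℕ) (k l : Fin N) : R :=
  if k = l then (if (k : ℕ) < m then x else -xinv) else if k < l then x - xinv else 0

theorem Tent_eq (x xinv : R) (m : ℕ) (p p' : Fin N × Fin N) :
    Tent x xinv m p p' = swapCoeff R m p.1 p.2 * (if p' = (p.2, p.1) then 1 else 0) +
      diagCoeff x xinv m p.1 p.2 * (if p' = p then 1 else 0) := by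
  simp only [Tent, swapCoeff, diagCoeff, Fin.lt_def]
  split_ifs <;> simp

/-- The two-site operator `T` acting on the tensor positions `i` and `j`, as an operator on the
functions on the standard basis. -/
def heckeAct (x xinv : R) (m : ℕ) (i j : Fin r) (f : (Fin r → Fin N) → R) (a : Fin r → Fin N) :
    R :=
  swapCoeff R m (a i) (a j) * f (a ∘ Equiv.swap i j) + diagCoeff x xinv m (a i) (a j) * f a

theorem heckeOp_mulVec (x xinv : R) (m i : ℕ) (h : i + 1 < r) (f : (Fin r → Fin N) → R) :
    (heckeOp x xinv m r i h).mulVec f =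
      heckeAct x xinv m ⟨i, Nat.lt_of_succ_lt h⟩ ⟨i + 1, h⟩ f := by
  funext a
  set s : Fin r := ⟨i, Nat.lt_of_succ_lt h⟩ with hs
  set s' : Fin r := ⟨i + 1, h⟩ with hs'
  have hprod : ∀ b : Fin r → Fin N,
      (∏ j ∈ Finset.univ \ ({s, s'} : Finset (Fin r)), if a j = b j then (1 : R) else 0) =
        if ∀ j, j ≠ s → j ≠ s' → a j = b j then 1 else 0 := by
    intro b
    rw [Finset.prod_ite_zero]
    simp
  have hswap : ∀ b : Fin r → Fin N,
      ((b s, b s') = (a s', a s) ∧ ∀ j, j ≠ s → j ≠ s' → a j = b j) ↔ b = a ∘ Equiv.swap s s' := by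
    intro b
    rw [Prod.mk.injEq]
    constructor
    · rintro ⟨⟨h1, h2⟩, h3⟩
      funext j
      rcases eq_or_ne j s with rfl | hjs
      · simpa using h1
      rcases eq_or_ne j s' with rfl | hjs'
      · simpa using h2
      · simp [Equiv.swap_apply_of_ne_of_ne hjs hjs', h3 j hjs hjs']
    · rintro rfl
      refine ⟨by simp, fun j hjs hjs' => ?_⟩
      simp [Equiv.swap_apply_of_ne_of_ne hjs hjs']
  have hdiag : ∀ b : Fin r → Fin N,
      ((b s, b s') = (a s, a s') ∧ ∀ j, j ≠ s → j ≠ s' → a j = b j) ↔ b = a := by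
    intro b
    rw [Prod.mk.injEq]
    constructor
    · rintro ⟨⟨h1, h2⟩, h3⟩
      funext j
      rcases eq_or_ne j s with rfl | hjs
      · exact h1
      rcases eq_or_ne j s' with rfl | hjs'
      · exact h2
      · exact (h3 j hjs hjs').symm
    · rintro rfl
      simp
  have hentry : ∀ b, heckeOp x xinv m r i h a b =
      swapCoeff R m (a s) (a s') * (if b = a ∘ Equiv.swap s s' then 1 else 0) +
        diagCoeff x xinv m (a s) (a s') * (if b = a then 1 else 0) := by
    intro b
    rw [heckeOp, twoSiteOp, Tent_eq, hprod, add_mul, mul_assoc, mul_assoc, ite_zero_mul_ite_zero,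
      ite_zero_mul_ite_zero, mul_one]
    rw [if_congr (hswap b) rfl rfl, if_congr (hdiag b) rfl rfl]
  simp [Matrix.mulVec, dotProduct, hentry, heckeAct, add_mul, Finset.sum_add_distrib]

theorem heckeAct_commute (x xinv : R) (m : ℕ) {i j k l : Fin r} (hik : i ≠ k) (hil : i ≠ l)
    (hjk : j ≠ k) (hjl : j ≠ l) (f : (Fin r → Fin N) → R) :
    heckeAct x xinv m i j (heckeAct x xinv m k l f) =
      heckeAct x xinv m k l (heckeAct x xinv m i j f) := by
  funext a
  have hsw : (a ∘ Equiv.swap i j) ∘ Equiv.swap k l = (a ∘ Equiv.swap k l) ∘ Equiv.swap i j := by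
    funext c
    simp only [Function.comp_apply, Equiv.swap_apply_def]
    congr 1
    grind
  simp only [heckeAct, hsw, Function.comp_apply, Equiv.swap_apply_of_ne_of_ne hik hil,
    Equiv.swap_apply_of_ne_of_ne hjk hjl, Equiv.swap_apply_of_ne_of_ne hik.symm hjk.symm,
    Equiv.swap_apply_of_ne_of_ne hil.symm hjl.symm]
  ring

theorem heckeAct_heckeAct {x xinv : R} (hx : x * xinv = 1) (m : ℕ) (i j : Fin r)
    (f : (Fin r → Fin N) → R) :
    heckeAct x xinv m i j (heckeAct x xinv m i j f) =
      (x - xinv) • heckeAct x xinv m i j f + f := by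
  funext a
  have hsw : (a ∘ Equiv.swap i j) ∘ Equiv.swap i j = a := by
    funext k; simp
  simp only [heckeAct, hsw, Function.comp_apply, Equiv.swap_apply_left, Equiv.swap_apply_right,
    Pi.add_apply, Pi.smul_apply, smul_eq_mul, swapCoeff, diagCoeff]
  have hs := sgn_mul_self (R := R) m (a i) (a j)
  have hs' := sgn_comm (R := R) m (a j) (a i)
  rcases lt_trichotomy (a i) (a j) with h | h | h
  · simp only [h, h.ne, h.ne', h.not_gt, if_true, if_false, hs']
    linear_combination f a * hs
  · simp only [h, if_true]
    split_ifs <;> linear_combination f a * hx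
  · simp only [h, h.ne, h.ne', h.not_gt, if_true, if_false, hs']
    linear_combination f a * hs

theorem heckeAct_braid {x xinv : R} (hx : x * xinv = 1) (m : ℕ) {i j k : Fin r} (hij : i ≠ j)
    (hik : i ≠ k) (hjk : j ≠ k) (f : (Fin r → Fin N) → R) :
    heckeAct x xinv m i j (heckeAct x xinv m j k (heckeAct x xinv m i j f)) =
      heckeAct x xinv m j k (heckeAct x xinv m i j (heckeAct x xinv m j k f)) := by
  funext a
  have h1 : ((a ∘ Equiv.swap i j) ∘ Equiv.swap j k) ∘ Equiv.swap i j =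
      ((a ∘ Equiv.swap j k) ∘ Equiv.swap i j) ∘ Equiv.swap j k := by
    funext c
    simp only [Function.comp_apply, Equiv.swap_apply_def]
    congr 1
    grind
  have h2 : (a ∘ Equiv.swap i j) ∘ Equiv.swap i j = a := by funext k; simp
  have h3 : (a ∘ Equiv.swap j k) ∘ Equiv.swap j k = a := by funext k; simp
  simp only [heckeAct, h1, h2, h3, Function.comp_apply, Equiv.swap_apply_left,
    Equiv.swap_apply_right,
    Equiv.swap_apply_of_ne_of_ne hij hik, Equiv.swap_apply_of_ne_of_ne hik.symm hjk.symm]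
  generalize f (a ∘ Equiv.swap i j) = f1
  generalize f (a ∘ Equiv.swap j k) = f2
  generalize f ((a ∘ Equiv.swap i j) ∘ Equiv.swap j k) = f12
  generalize f ((a ∘ Equiv.swap j k) ∘ Equiv.swap i j) = f21
  generalize f (((a ∘ Equiv.swap j k) ∘ Equiv.swap i j) ∘ Equiv.swap j k) = f121
  generalize f a = f0
  generalize a i = p
  generalize a j = q
  generalize a k = s
  have hpq := sgn_mul_self (R := R) m p q
  have hps := sgn_mul_self (R := R) m p s
  have hqs := sgn_mul_self (R := R) m q s
  simp only [swapCoeff, diagCoeff, sgn_comm m q p, sgn_comm m s q]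
  rcases lt_trichotomy p q with h | h | h <;> rcases lt_trichotomy q s with h' | h' | h' <;>
    rcases lt_trichotomy p s with h'' | h'' | h'' <;> first | (exfalso; order) | skip
  all_goals
    try subst h
    try subst h'
    try subst h''
    simp only [*, lt_irrefl, ne_of_gt, ne_of_lt, not_lt_of_gt, if_true, if_false]
  all_goals grind

/-- The operator `T_{i+1}`, extended by the identity to all `i`. -/
def heckeGen (x xinv : R) (m N r i : ℕ) : Matrix (Fin r → Fin N) (Fin r → Fin N) R :=
  if h : i + 1 < r then heckeOp x xinv m r i h else 1

theorem heckeGen_of_lt (x xinv : R) (m N : ℕ) {i : ℕ} (h : i + 1 < r) :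
    heckeGen x xinv m N r i = heckeOp x xinv m r i h := dif_pos h

theorem heckeGen_of_le (x xinv : R) (m N : ℕ) {i : ℕ} (h : r - 1 ≤ i) :
    heckeGen x xinv m N r i = 1 := dif_neg (by omega)

theorem heckeRelations_heckeGen {x xinv : R} (hx : x * xinv = 1) (m N r : ℕ) :
    HeckeRelations (x - xinv) (heckeGen x xinv m N r) (r - 1) where
  quad i hi := by
    rw [heckeGen_of_lt x xinv m N (by omega : i + 1 < r)]
    refine Matrix.ext_of_mulVec_single fun a => ?_
    simp only [← Matrix.mulVec_mulVec, Matrix.add_mulVec, Matrix.smul_mulVec, Matrix.one_mulVec,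
      heckeOp_mulVec, heckeAct_heckeAct hx]
  braid i hi := by
    rw [heckeGen_of_lt x xinv m N (by omega : i + 1 < r),
      heckeGen_of_lt x xinv m N (by omega : i + 1 + 1 < r)]
    refine Matrix.ext_of_mulVec_single fun a => ?_
    simp only [← Matrix.mulVec_mulVec, heckeOp_mulVec]
    refine heckeAct_braid hx m ?_ ?_ ?_ _ <;> rw [Ne, Fin.mk.injEq] <;> omega
  comm i j hij hj := by
    rw [heckeGen_of_lt x xinv m N (by omega : i + 1 < r),
      heckeGen_of_lt x xinv m N (by omega : j + 1 < r)]
    refine Matrix.ext_of_mulVec_single fun a => ?_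
    simp only [← Matrix.mulVec_mulVec, heckeOp_mulVec]
    refine heckeAct_commute x xinv m ?_ ?_ ?_ ?_ _ <;> rw [Ne, Fin.mk.injEq] <;> omega

theorem heckeGen_map {S : Type*} [CommRing S] (φ : R →+* S) (x xinv : R) (m N r i : ℕ) :
    (heckeGen x xinv m N r i).map φ = heckeGen (φ x) (φ xinv) m N r i := by
  unfold heckeGen
  split_ifs with h
  · ext a b
    simp only [Matrix.map_apply, heckeOp, twoSiteOp, Tent, sgn, map_mul, map_prod, map_add,
      map_sub, map_neg, map_pow, map_one, map_zero, apply_ite φ]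
  · exact Matrix.map_one φ (map_zero φ) (map_one φ)

theorem adjoin_range_heckeGen (x xinv : R) (m N r : ℕ) :
    Algebra.adjoin R (Set.range (heckeGen x xinv m N r)) =
      Algebra.adjoin R (heckeGens x xinv m (N := N) r) := by
  apply le_antisymm
  · refine Algebra.adjoin_le ?_
    rintro _ ⟨i, rfl⟩
    by_cases h : i + 1 < r
    · exact Algebra.subset_adjoin ⟨i, h, heckeGen_of_lt x xinv m N h⟩
    · rw [heckeGen, dif_neg h]
      exact one_mem _
  · refine Algebra.adjoin_mono ?_
    rintro _ ⟨i, h, rfl⟩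
    exact ⟨i, heckeGen_of_lt x xinv m N h⟩

theorem heckeGens_one_one (m N r : ℕ) :
    heckeGens (1 : R) 1 m (N := N) r = swapGens R m r := by
  have hT : (Tent (1 : R) 1 m : Fin N × Fin N → Fin N × Fin N → R) = Pent R m := by
    funext ⟨k, l⟩ p'
    rcases eq_or_ne k l with rfl | h
    · simp only [Tent, Pent, sgn, deg, if_true]
      split_ifs <;> simp
    · simp [Tent, Pent, h]
  simp only [heckeGens, swapGens, heckeOp, swapOp, hT]

end HeckeOperators

section Dimension

theorem finrank_subalgebra_mono {K A : Type*} [Field K] [Ring A] [Algebra K A]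
    [FiniteDimensional K A] {S S' : Subalgebra K A} (h : S ≤ S') :
    Module.finrank K S ≤ Module.finrank K S' :=
  Submodule.finrank_mono (Subalgebra.toSubmodule.monotone h)

theorem map_relTrace_single {R K n : Type*} [CommRing R] [CommRing K] [Fintype n] [DecidableEq n]
    (φ : R →+* K) (T : ℕ → Matrix n n R) (k : ℕ) (u : n × n) :
    (relTrace R T k (.single u.1 u.2 1)).map φ =
      relTrace K (fun i => (T i).map φ) k (.single u.1 u.2 1) := by
  have h := map_relTrace (K := R) (L := K) (φ.mapMatrix (m := n)) T k (.single u.1 u.2 1)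
  simpa only [RingHom.mapMatrix_apply, Matrix.map_single, map_one] using h

/-- At `q = 1` the commutant of all relative traces is the algebra generated by the `T_i`. -/
theorem centralizer_relTrace_le_adjoin {K n : Type*} [Field K] [CharZero K] [Fintype n]
    [DecidableEq n] {T : ℕ → Matrix n n K} {k : ℕ} (h : HeckeRelations (0 : K) T k)
    (hk : ∀ i, k ≤ i → T i = 1) :
    Subalgebra.centralizer K
      (Set.range fun u : n × n => relTrace K T k (Matrix.single u.1 u.2 1)) ≤
      Algebra.adjoin K (Set.range T) := by
  intro W hW
  rw [Subalgebra.mem_centralizer_iff, Set.forall_mem_range] at hW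
  refine centralizer_centralizer_le_adjoin h hk fun Y hY => ?_
  have hall : ∀ Y, relTrace K T k Y * W = W * relTrace K T k Y := by
    have : LinearMap.mulRight K W ∘ₗ relTrace K T k = LinearMap.mulLeft K W ∘ₗ relTrace K T k := by
      refine Matrix.ext_linearMap K fun b j => LinearMap.ext_ring ?_
      simpa using hW (b, j)
    exact LinearMap.congr_fun this
  have hY' := hall Y
  rw [relTrace_of_involutive (fun i hi => by simpa using h.quad i hi)
    (fun i _ => hY _ ⟨i, rfl⟩), smul_mul_assoc, mul_smul_comm] at hY'
  exact smul_right_injective _ (Nat.cast_ne_zero.2 (k + 1).factorial_ne_zero) hY'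

/-- The dimension of the algebra generated by the Hecke operators at an injective specialization
of the parameter agrees with the dimension at parameter `1`. -/
theorem finrank_adjoin_heckeGens {R K L : Type*} [CommRing R] [Field K] [Field L] [CharZero L]
    {x xinv : R} (hx : x * xinv = 1) (φ : R →+* K) (hφ : Function.Injective φ) (ψ : R →+* L)
    (hψ : ψ x = 1) (m N r : ℕ) :
    Module.finrank K (Algebra.adjoin K (heckeGens (φ x) (φ xinv) m (N := N) r)) =
      Module.finrank L (Algebra.adjoin L (swapGens L m (N := N) r)) := by
  have hψ' : ψ xinv = 1 := by simpa [hψ] using congrArg ψ hx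
  have hφx : φ x * φ xinv = 1 := by rw [← map_mul, hx, map_one]
  rw [← heckeGens_one_one, ← adjoin_range_heckeGen, ← adjoin_range_heckeGen]
  have hTφ : (fun i => (heckeGen x xinv m N r i).map φ) = heckeGen (φ x) (φ xinv) m N r :=
    funext (heckeGen_map φ x xinv m N r)
  have hTψ : (fun i => (heckeGen x xinv m N r i).map ψ) = heckeGen (1 : L) 1 m N r := by
    simpa only [hψ, hψ'] using funext (heckeGen_map ψ x xinv m N r)
  let X (u : (Fin r → Fin N) × (Fin r → Fin N)) : Matrix (Fin r → Fin N) (Fin r → Fin N) R :=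
    relTrace R (heckeGen x xinv m N r) (r - 1) (.single u.1 u.2 1)
  have hXφ : (fun u => (X u).map φ) = fun u =>
      relTrace K (heckeGen (φ x) (φ xinv) m N r) (r - 1) (.single u.1 u.2 1) := by
    rw [← hTφ]
    exact funext (map_relTrace_single φ _ _)
  have hXψ : (fun u => (X u).map ψ) = fun u =>
      relTrace L (heckeGen (1 : L) 1 m N r) (r - 1) (.single u.1 u.2 1) := by
    rw [← hTψ]
    exact funext (map_relTrace_single ψ _ _)
  apply le_antisymm
  · calc Module.finrank K (Algebra.adjoin K (Set.range (heckeGen (φ x) (φ xinv) m N r)))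
        ≤ Module.finrank K (Subalgebra.centralizer K (Set.range fun u => (X u).map φ)) := by
          refine finrank_subalgebra_mono (Algebra.adjoin_le ?_)
          rw [hXφ]
          rintro _ ⟨i, rfl⟩ _ ⟨u, rfl⟩
          by_cases hi : i < r - 1
          · exact ((heckeRelations_heckeGen hφx m N r).commute_relTrace _ i hi).eq.symm
          · rw [heckeGen_of_le _ _ _ _ (by omega), one_mul, mul_one]
      _ ≤ Module.finrank L (Subalgebra.centralizer L (Set.range fun u => (X u).map ψ)) :=
          finrank_centralizer_le_specialization φ hφ ψ X
      _ ≤ _ := by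
          rw [hXψ]
          exact finrank_subalgebra_mono <| centralizer_relTrace_le_adjoin
            (by simpa using heckeRelations_heckeGen (one_mul (1 : L)) m N r)
            fun i hi => heckeGen_of_le _ _ _ _ hi
  · have h := finrank_adjoin_specialization_le φ hφ ψ (heckeGen x xinv m N r)
    rwa [hTφ, hTψ] at h

end Dimension

open LaurentPolynomial in
theorem injective_laurent_eval₂ {A : Type*} [CommRing A] [Algebra ℚ A] (t : Aˣ)
    (ht : Transcendental ℚ (t : A)) :
    Function.Injective (LaurentPolynomial.eval₂ (algebraMap ℚ A) t) := by
  rw [injective_iff_map_eq_zero]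
  intro f hf
  obtain ⟨n, p, hp⟩ := f.exists_T_pow
  have hp0 : Polynomial.aeval (t : A) p = 0 := by
    rw [Polynomial.aeval_def, ← eval₂_toLaurent, hp, map_mul, hf, zero_mul]
  rw [transcendental_iff.1 ht p hp0, map_zero] at hp
  exact ((isUnit_T n).mul_left_eq_zero).1 hp.symm

/-- For `t ∈ ℂ` transcendental over `ℚ`, `dim_ℂ 𝒮_t = dim_ℂ 𝒮_1`:
the algebra generated by the specialized Hecke operators `T_i(t)` has the same dimension
as the algebra generated by the signed swap operators `P_i` (the specialization at
`t = 1`). -/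
theorem dim_St_eq_dim_S1 (t : ℂ) (ht : Transcendental ℚ t)
    (m n r : ℕ) (hm : 1 ≤ m) (hn : 1 ≤ n) (hr : 2 ≤ r) :
    Module.finrank ℂ (St t m n r)
      = Module.finrank ℂ
          (Algebra.adjoin ℂ (swapGens ℂ m (N := m + n) r :
            Set (Matrix (Fin r → Fin (m + n)) (Fin r → Fin (m + n)) ℂ))) := by
  have ht0 : t ≠ 0 := fun h => ht (h ▸ isAlgebraic_zero)
  have h := finrank_adjoin_heckeGens (x := (LaurentPolynomial.T 1 : LaurentPolynomial ℚ))
    (xinv := LaurentPolynomial.T (-1)) (by rw [← LaurentPolynomial.T_add]; simp)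
    (LaurentPolynomial.eval₂ (algebraMap ℚ ℂ) (Units.mk0 t ht0))
    (injective_laurent_eval₂ _ ht) (LaurentPolynomial.eval₂ (algebraMap ℚ ℂ) 1) (by simp)
    m (m + n) r
  have hT : LaurentPolynomial.eval₂ (algebraMap ℚ ℂ) (Units.mk0 t ht0) (.T 1) = t := by simp
  have hT' : LaurentPolynomial.eval₂ (algebraMap ℚ ℂ) (Units.mk0 t ht0) (.T (-1)) = t⁻¹ := by simp
  rwa [hT, hT'] at h
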